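/- arXiv:2602.01650 — 4 statements merged into one kernel-verified Lean document; each statement's English description precedes it below -/
import Mathlib

section
/- With respect to the canonical grading, the Leavitt algebra L(m,n) is strongly graded: the components (L(m,n)_k)_{k∈ℤ} form an internal direct sum decomposition of L(m,n) as a K-vector space, and for all i, j ∈ ℤ one has L(m,n)_i · L(m,n)_j = L(m,n)_{i+j}, where the product of two K-submodules is the K-linear span of all pairwise products. -/
open scoped BigOperators

/-- Generators of the Leavitt algebra `L(m,n)`: `Sum.inl (i,j)` is the x-letter `x_{ij}`
(`1 ≤ i ≤ m`, `1 ≤ j ≤ n`, written 0-indexed), and `Sum.inr (j,i)` is the y-letter `y_{ji}`. -/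
abbrev LGen (m n : ℕ) := (Fin m × Fin n) ⊕ (Fin n × Fin m)

/-- The defining relations of the Leavitt algebra `L(m,n)`:
`∑_j x_{ij} y_{ji'} = δ_{i,i'}` and `∑_i y_{ji} x_{ij'} = δ_{j,j'}`. -/
inductive LRel (K : Type) [Field K] (m n : ℕ) :
    FreeAlgebra K (LGen m n) → FreeAlgebra K (LGen m n) → Prop
  | xy (i i' : Fin m) :
      LRel K m n
        (∑ j : Fin n, FreeAlgebra.ι K (Sum.inl (i, j)) * FreeAlgebra.ι K (Sum.inr (j, i')))
        (if i = i' then 1 else 0)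
  | yx (j j' : Fin n) :
      LRel K m n
        (∑ i : Fin m, FreeAlgebra.ι K (Sum.inr (j, i)) * FreeAlgebra.ι K (Sum.inl (i, j')))
        (if j = j' then 1 else 0)

/-- The Leavitt algebra `L(m,n)`, presented by the generators `x_{ij}, y_{ji}` and the
relations `∑_j x_{ij} y_{ji'} = δ_{i,i'}`, `∑_i y_{ji} x_{ij'} = δ_{j,j'}`. -/
abbrev Leavitt (K : Type) [Field K] (m n : ℕ) := RingQuot (LRel K m n)

/-- The image of a generator in `L(m,n)`. -/
noncomputable def lgen (K : Type) [Field K] {m n : ℕ} (z : LGen m n) : Leavitt K m n :=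
  RingQuot.mkAlgHom K (LRel K m n) (FreeAlgebra.ι K z)

/-- The generator `x_{ij}` of `L(m,n)` (0-indexed). -/
noncomputable def xg (K : Type) [Field K] {m n : ℕ} (i : Fin m) (j : Fin n) : Leavitt K m n :=
  lgen K (Sum.inl (i, j))

/-- The generator `y_{ji}` of `L(m,n)` (0-indexed). -/
noncomputable def yg (K : Type) [Field K] {m n : ℕ} (j : Fin n) (i : Fin m) : Leavitt K m n :=
  lgen K (Sum.inr (j, i))

/-- A word over the generating set `X` of `L(m,n)`. -/
abbrev LWord (m n : ℕ) := List (LGen m n)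

/-- The image of a word in `L(m,n)` (product of the images of its letters). -/
noncomputable def wordToL (K : Type) [Field K] {m n : ℕ} (w : LWord m n) : Leavitt K m n :=
  (w.map (lgen K)).prod

/-- A word is balanced if it has equally many x-letters and y-letters. -/
def LWord.Balanced {m n : ℕ} (w : LWord m n) : Prop :=
  w.countP Sum.isLeft = w.countP Sum.isRight

/-- The degree of a word: number of x-letters minus number of y-letters. -/
def LWord.degree {m n : ℕ} (w : LWord m n) : ℤ :=
  (w.countP Sum.isLeft : ℤ) - (w.countP Sum.isRight : ℤ)

/-- The `k`-component of the canonical grading of `L(m,n)`: the `K`-linear span of the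
images of all words of degree `k`. -/
noncomputable def Lcomponent (K : Type) [Field K] (m n : ℕ) (k : ℤ) :
    Submodule K (Leavitt K m n) :=
  Submodule.span K {a | ∃ w : LWord m n, w.degree = k ∧ wordToL K w = a}

/-- A pair of consecutive letters is forbidden if it is of the form `x_{in} y_{ni'}` or
`y_{jm} x_{mj'}` (the second index of the first letter being maximal). -/
def LForbidden {m n : ℕ} (z z' : LGen m n) : Prop :=
  (∃ (i i' : Fin m) (j : Fin n), (j : ℕ) = n - 1 ∧ z = Sum.inl (i, j) ∧ z' = Sum.inr (j, i')) ∨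
  (∃ (j j' : Fin n) (i : Fin m), (i : ℕ) = m - 1 ∧ z = Sum.inr (j, i) ∧ z' = Sum.inl (i, j'))

/-- A word is irreducible if it contains no forbidden subword `x_{in} y_{ni'}` or
`y_{jm} x_{mj'}`. -/
def LWord.Irr {m n : ℕ} (w : LWord m n) : Prop :=
  ∀ (u v : LWord m n) (z z' : LGen m n), w = u ++ z :: z' :: v → ¬ LForbidden z z'

/-- A nonempty balanced word is prime if it is not the concatenation of two nonempty
balanced words. -/
def LWord.IsPrime {m n : ℕ} (w : LWord m n) : Prop :=
  w ≠ [] ∧ w.Balanced ∧ ∀ u v : LWord m n, w = u ++ v → u ≠ [] → v ≠ [] → ¬ u.Balanced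

/-- An xy word: a nonempty balanced word whose first letter is an x-letter and whose
last letter is a y-letter. -/
def LWord.XY {m n : ℕ} (w : LWord m n) : Prop :=
  w.Balanced ∧ (∃ p, w.head? = some (Sum.inl p)) ∧ (∃ q, w.getLast? = some (Sum.inr q))

/-- A yx word: a nonempty balanced word whose first letter is a y-letter and whose
last letter is an x-letter. -/
def LWord.YX {m n : ℕ} (w : LWord m n) : Prop :=
  w.Balanced ∧ (∃ q, w.head? = some (Sum.inr q)) ∧ (∃ p, w.getLast? = some (Sum.inl p))

/-- Membership in the submonoid `⟨X⟩₀^{xy}` of `⟨X⟩₀` generated by the prime xy words. -/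
def LWord.InXY {m n : ℕ} (w : LWord m n) : Prop :=
  ∃ ws : List (LWord m n), (∀ u ∈ ws, u.IsPrime ∧ u.XY) ∧ ws.flatten = w

/-- Membership in the submonoid `⟨X⟩₀^{yx}` of `⟨X⟩₀` generated by the prime yx words. -/
def LWord.InYX {m n : ℕ} (w : LWord m n) : Prop :=
  ∃ ws : List (LWord m n), (∀ u ∈ ws, u.IsPrime ∧ u.YX) ∧ ws.flatten = w

/-- The subalgebra `L(m,n)₀^{xy}` of `L(m,n)` generated by images of all prime xy words. -/
noncomputable def L0xy (K : Type) [Field K] (m n : ℕ) : Subalgebra K (Leavitt K m n) :=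
  Algebra.adjoin K {a | ∃ w : LWord m n, w.IsPrime ∧ w.XY ∧ wordToL K w = a}

/-- The subalgebra `L(m,n)₀^{yx}` of `L(m,n)` generated by images of all prime yx words. -/
noncomputable def L0yx (K : Type) [Field K] (m n : ℕ) : Subalgebra K (Leavitt K m n) :=
  Algebra.adjoin K {a | ∃ w : LWord m n, w.IsPrime ∧ w.YX ∧ wordToL K w = a}

/-- The zero component `L(m,n)₀`, as a subalgebra: it is generated (indeed spanned)
by the images of all balanced words. -/
noncomputable def L0 (K : Type) [Field K] (m n : ℕ) : Subalgebra K (Leavitt K m n) :=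
  Algebra.adjoin K {a | ∃ w : LWord m n, w.Balanced ∧ wordToL K w = a}

namespace Leavitt

variable {K : Type} [Field K] {m n : ℕ}

theorem degree_append (v w : LWord m n) :
    LWord.degree (v ++ w) = LWord.degree v + LWord.degree w := by
  simp only [LWord.degree, List.countP_append]
  push_cast
  ring

theorem degree_nil : LWord.degree ([] : LWord m n) = 0 := by
  simp [LWord.degree]

theorem degree_singleton_inl (p : Fin m × Fin n) :
    LWord.degree [(Sum.inl p : LGen m n)] = 1 := by
  simp [LWord.degree]

theorem degree_singleton_inr (q : Fin n × Fin m) :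
    LWord.degree [(Sum.inr q : LGen m n)] = -1 := by
  simp [LWord.degree]

theorem wordToL_nil : wordToL K ([] : LWord m n) = 1 := by
  simp [wordToL]

theorem wordToL_append (v w : LWord m n) :
    wordToL K (v ++ w) = wordToL K v * wordToL K w := by
  simp [wordToL]

theorem wordToL_mem (w : LWord m n) : wordToL K w ∈ Lcomponent K m n (LWord.degree w) :=
  Submodule.subset_span ⟨w, rfl, rfl⟩

theorem lgen_mem (z : LGen m n) : lgen K z ∈ Lcomponent K m n (LWord.degree [z]) := by
  simpa [wordToL] using wordToL_mem (K := K) [z]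

theorem component_mul_le (i j : ℤ) :
    Lcomponent K m n i * Lcomponent K m n j ≤ Lcomponent K m n (i + j) := by
  rw [Lcomponent, Lcomponent, Submodule.span_mul_span, Submodule.span_le]
  rintro _ ⟨_, ⟨v, rfl, rfl⟩, _, ⟨w, rfl, rfl⟩, rfl⟩
  exact Submodule.subset_span ⟨v ++ w, degree_append v w, wordToL_append v w⟩

instance gradedMonoid : SetLike.GradedMonoid (Lcomponent K m n) where
  one_mem := by
    rw [← wordToL_nil, ← degree_nil]
    exact wordToL_mem []
  mul_mem i j _ _ ha hb := component_mul_le i j (Submodule.mul_mem_mul ha hb)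

theorem sum_xg_mul_yg (i i' : Fin m) :
    ∑ j : Fin n, xg K i j * yg K j i' = if i = i' then 1 else 0 := by
  simpa [xg, yg, lgen, apply_ite] using RingQuot.mkAlgHom_rel K (LRel.xy (K := K) (n := n) i i')

theorem sum_yg_mul_xg (j j' : Fin n) :
    ∑ i : Fin m, yg K j i * xg K i j' = if j = j' then 1 else 0 := by
  simpa [xg, yg, lgen, apply_ite] using RingQuot.mkAlgHom_rel K (LRel.yx (K := K) (m := m) j j')

theorem xg_mem (i : Fin m) (j : Fin n) : xg K i j ∈ Lcomponent K m n 1 := by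
  rw [← degree_singleton_inl (i, j)]
  exact lgen_mem _

theorem yg_mem (j : Fin n) (i : Fin m) : yg K j i ∈ Lcomponent K m n (-1) := by
  rw [← degree_singleton_inr (j, i)]
  exact lgen_mem _

/-- The coaction of `K[ℤ]` on `L(m,n)` which sends a generator `z` to `z T ^ deg z`. -/
noncomputable def coaction (K : Type) [Field K] (m n : ℕ) :
    Leavitt K m n →ₐ[K] AddMonoidAlgebra (Leavitt K m n) ℤ :=
  RingQuot.liftAlgHom K
    ⟨FreeAlgebra.lift K fun z => AddMonoidAlgebra.single (LWord.degree [z]) (lgen K z), by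
      rintro _ _ (⟨i, i'⟩ | ⟨j, j'⟩)
      · have h := congrArg (AddMonoidAlgebra.singleAddHom (0 : ℤ))
          (sum_xg_mul_yg (K := K) (n := n) i i')
        rw [map_sum, apply_ite (AddMonoidAlgebra.singleAddHom (0 : ℤ)), map_zero] at h
        simp only [map_sum, map_mul, FreeAlgebra.lift_ι_apply, AddMonoidAlgebra.single_mul_single,
          degree_singleton_inl, degree_singleton_inr]
        rw [apply_ite (FreeAlgebra.lift K _), map_one, map_zero]
        exact h
      · have h := congrArg (AddMonoidAlgebra.singleAddHom (0 : ℤ))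
          (sum_yg_mul_xg (K := K) (m := m) j j')
        rw [map_sum, apply_ite (AddMonoidAlgebra.singleAddHom (0 : ℤ)), map_zero] at h
        simp only [map_sum, map_mul, FreeAlgebra.lift_ι_apply, AddMonoidAlgebra.single_mul_single,
          degree_singleton_inl, degree_singleton_inr]
        rw [apply_ite (FreeAlgebra.lift K _), map_one, map_zero]
        exact h⟩

theorem coaction_lgen (z : LGen m n) :
    coaction K m n (lgen K z) = AddMonoidAlgebra.single (LWord.degree [z]) (lgen K z) := by
  simp [coaction, lgen]

theorem coaction_wordToL (w : LWord m n) :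
    coaction K m n (wordToL K w) = AddMonoidAlgebra.single (LWord.degree w) (wordToL K w) := by
  induction w with
  | nil => rw [wordToL_nil, degree_nil, map_one, AddMonoidAlgebra.one_def]
  | cons z w ih =>
    rw [← List.singleton_append, wordToL_append, degree_append, map_mul, ih,
      ← AddMonoidAlgebra.single_mul_single]
    simp [wordToL, coaction_lgen]

theorem coaction_of_mem {k : ℤ} {a : Leavitt K m n} (ha : a ∈ Lcomponent K m n k) :
    coaction K m n a = AddMonoidAlgebra.single k a := by
  induction ha using Submodule.span_induction with
  | mem a ha =>
    obtain ⟨w, rfl, rfl⟩ := ha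
    exact coaction_wordToL w
  | zero => simp
  | add a b _ _ ha hb => rw [map_add, ha, hb, AddMonoidAlgebra.single_add]
  | smul c a _ ha => rw [map_smul, ha, AddMonoidAlgebra.smul_single]

theorem coaction_coe_apply (d : DirectSum ℤ fun k => Lcomponent K m n k) (k : ℤ) :
    (coaction K m n (DirectSum.coeAddMonoidHom (Lcomponent K m n) d)).coeff k = d k := by
  classical
  induction d using DirectSum.induction_on with
  | zero => simp
  | of i a =>
    rw [DirectSum.coeAddMonoidHom_of, coaction_of_mem a.2, DirectSum.coe_of_apply]
    rw [AddMonoidAlgebra.coeff_single, Finsupp.single_apply]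
    split_ifs <;> rfl
  | add a b ha hb => simp [ha, hb]

theorem coeAlgHom_surjective :
    Function.Surjective (DirectSum.coeAlgHom (Lcomponent K m n)) := by
  have h : (DirectSum.coeAlgHom (Lcomponent K m n)).comp (FreeAlgebra.lift K fun z =>
      DirectSum.of (fun k => Lcomponent K m n k) (LWord.degree [z]) ⟨lgen K z, lgen_mem z⟩) =
      RingQuot.mkAlgHom K (LRel K m n) := by
    ext z
    simp [lgen]
  refine Function.Surjective.of_comp (g := FreeAlgebra.lift K fun z =>
      DirectSum.of (fun k => Lcomponent K m n k) (LWord.degree [z]) ⟨lgen K z, lgen_mem z⟩) ?_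
  rw [← AlgHom.coe_comp, h]
  exact RingQuot.mkAlgHom_surjective K _

theorem isInternal : DirectSum.IsInternal fun k : ℤ => Lcomponent K m n k := by
  refine ⟨fun d e h => ?_, coeAlgHom_surjective⟩
  ext k
  rw [← coaction_coe_apply, ← coaction_coe_apply, h]

theorem one_le_component_one_mul (hm : 0 < m) :
    1 ≤ Lcomponent K m n 1 * Lcomponent K m n (-1) := by
  have h := sum_xg_mul_yg (K := K) (n := n) (⟨0, hm⟩ : Fin m) ⟨0, hm⟩
  rw [if_pos rfl] at h
  rw [Submodule.one_le, ← h]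
  exact sum_mem fun j _ => Submodule.mul_mem_mul (xg_mem _ j) (yg_mem j _)

theorem one_le_component_neg_one_mul (hn : 0 < n) :
    1 ≤ Lcomponent K m n (-1) * Lcomponent K m n 1 := by
  have h := sum_yg_mul_xg (K := K) (m := m) (⟨0, hn⟩ : Fin n) ⟨0, hn⟩
  rw [if_pos rfl] at h
  rw [Submodule.one_le, ← h]
  exact sum_mem fun i _ => Submodule.mul_mem_mul (yg_mem _ i) (xg_mem i _)

theorem one_le_component_add_mul {a b : ℤ}
    (ha : 1 ≤ Lcomponent K m n a * Lcomponent K m n (-a))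
    (hb : 1 ≤ Lcomponent K m n b * Lcomponent K m n (-b)) :
    1 ≤ Lcomponent K m n (a + b) * Lcomponent K m n (-(a + b)) :=
  calc
    1 ≤ Lcomponent K m n a * 1 * Lcomponent K m n (-a) := by rwa [mul_one]
    _ ≤ Lcomponent K m n a * (Lcomponent K m n b * Lcomponent K m n (-b)) *
        Lcomponent K m n (-a) := by gcongr
    _ = (Lcomponent K m n a * Lcomponent K m n b) *
        (Lcomponent K m n (-b) * Lcomponent K m n (-a)) := by simp only [mul_assoc]
    _ ≤ Lcomponent K m n (a + b) * Lcomponent K m n (-b + -a) :=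
      mul_le_mul' (component_mul_le _ _) (component_mul_le _ _)
    _ = _ := by rw [neg_add_rev]

theorem one_le_component_mul (hm : 0 < m) (hn : 0 < n) (k : ℤ) :
    1 ≤ Lcomponent K m n k * Lcomponent K m n (-k) := by
  induction k with
  | zero =>
    rw [Submodule.one_le]
    simpa using Submodule.mul_mem_mul (SetLike.GradedOne.one_mem (A := Lcomponent K m n))
      (SetLike.GradedOne.one_mem (A := Lcomponent K m n))
  | succ k ih => exact one_le_component_add_mul ih (one_le_component_one_mul hm)
  | pred k ih =>
    exact one_le_component_add_mul ih (by simpa using one_le_component_neg_one_mul hn)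

theorem component_mul (hm : 0 < m) (hn : 0 < n) (i j : ℤ) :
    Lcomponent K m n i * Lcomponent K m n j = Lcomponent K m n (i + j) := by
  refine le_antisymm (component_mul_le i j) ?_
  calc
    Lcomponent K m n (i + j) = 1 * Lcomponent K m n (i + j) := (one_mul _).symm
    _ ≤ Lcomponent K m n i * Lcomponent K m n (-i) * Lcomponent K m n (i + j) :=
      mul_le_mul' (one_le_component_mul hm hn i) le_rfl
    _ = Lcomponent K m n i * (Lcomponent K m n (-i) * Lcomponent K m n (i + j)) := mul_assoc _ _ _
    _ ≤ Lcomponent K m n i * Lcomponent K m n (-i + (i + j)) :=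
      mul_le_mul' le_rfl (component_mul_le _ _)
    _ = Lcomponent K m n i * Lcomponent K m n j := by rw [neg_add_cancel_left]

end Leavitt

/-- With respect to the canonical grading, `L(m,n)` is strongly graded:
the components form an internal direct sum decomposition, and
`L(m,n)_i · L(m,n)_j = L(m,n)_{i+j}` for all `i, j ∈ ℤ`. -/
theorem stmt1 (K : Type) [Field K] (m n : ℕ) (hm : 0 < m) (hn : 0 < n) :
    DirectSum.IsInternal (fun k : ℤ => Lcomponent K m n k) ∧
    ∀ i j : ℤ, Lcomponent K m n i * Lcomponent K m n j = Lcomponent K m n (i + j) :=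
  ⟨Leavitt.isInternal, Leavitt.component_mul hm hn⟩
end

section
/- The images in L(m,n) of the words in B (the irreducible words with equally many x-letters and y-letters) form a K-linear basis of the zero component L(m,n)_0 of the canonical grading. -/
open scoped BigOperators

namespace LWord

variable {m n : ℕ}

theorem irr_nil : Irr ([] : LWord m n) := by
  intro u v z z' h
  simp at h

theorem irr_singleton (z : LGen m n) : Irr [z] := by
  intro u v a b h
  have := congrArg List.length h
  simp at this
  omega

theorem irr_cons_cons {z z' : LGen m n} {v : LWord m n} :
    Irr (z :: z' :: v) ↔ ¬ LForbidden z z' ∧ Irr (z' :: v) := by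
  constructor
  · intro h
    refine ⟨h [] v z z' rfl, fun u t a b e => h (z :: u) t a b ?_⟩
    rw [e, List.cons_append]
  · rintro ⟨h, h'⟩ u t a b e
    cases u with
    | nil =>
      simp only [List.nil_append, List.cons.injEq] at e
      obtain ⟨rfl, rfl, -⟩ := e
      exact h
    | cons c u =>
      simp only [List.cons_append, List.cons.injEq] at e
      exact h' u t a b e.2

theorem Irr.tail {z : LGen m n} {w : LWord m n} (h : Irr (z :: w)) : Irr w := by
  cases w with
  | nil => exact irr_nil
  | cons z' v => exact (irr_cons_cons.1 h).2

theorem forbidden_inl_inr {i i' : Fin m} {j j' : Fin n} :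
    LForbidden (Sum.inl (i, j)) (Sum.inr (j', i')) ↔ (j : ℕ) = n - 1 ∧ j' = j := by
  simp [LForbidden]

theorem forbidden_inr_inl {i i' : Fin m} {j j' : Fin n} :
    LForbidden (Sum.inr (j, i)) (Sum.inl (i', j')) ↔ (i : ℕ) = m - 1 ∧ i' = i := by
  simp [LForbidden]

theorem not_forbidden_inl_inl (p q : Fin m × Fin n) :
    ¬ LForbidden (Sum.inl p) (Sum.inl q) := by
  simp [LForbidden]

theorem not_forbidden_inr_inr (p q : Fin n × Fin m) :
    ¬ LForbidden (Sum.inr p : LGen m n) (Sum.inr q) := by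
  simp [LForbidden]

/-- Irreducibility of a word depends on its first letter only through the second index. -/
theorem Irr.replace_inl {i i' : Fin m} {j : Fin n} {v : LWord m n}
    (h : Irr (Sum.inl (i, j) :: v)) : Irr (Sum.inl (i', j) :: v) := by
  rcases v with _ | ⟨⟨a, b⟩ | ⟨b, a⟩, v⟩
  · exact irr_singleton _
  · exact irr_cons_cons.2 ⟨not_forbidden_inl_inl _ _, h.tail⟩
  · rw [irr_cons_cons, forbidden_inl_inr] at *
    exact h

/-- Irreducibility of a word depends on its first letter only through the second index. -/
theorem Irr.replace_inr {j j' : Fin n} {i : Fin m} {v : LWord m n}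
    (h : Irr (Sum.inr (j, i) :: v)) : Irr (Sum.inr (j', i) :: v) := by
  rcases v with _ | ⟨⟨a, b⟩ | ⟨b, a⟩, v⟩
  · exact irr_singleton _
  · rw [irr_cons_cons, forbidden_inr_inl] at *
    exact h
  · exact irr_cons_cons.2 ⟨not_forbidden_inr_inr _ _, h.tail⟩

theorem degree_nil : degree ([] : LWord m n) = 0 := rfl

theorem degree_cons_inl (p : Fin m × Fin n) (w : LWord m n) :
    degree (Sum.inl p :: w) = degree w + 1 := by
  simp [degree, List.countP_cons]
  ring

theorem degree_cons_inr (p : Fin n × Fin m) (w : LWord m n) :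
    degree (Sum.inr p :: w) = degree w - 1 := by
  simp [degree, List.countP_cons]
  ring

theorem degree_cons (z : LGen m n) (w : LWord m n) :
    degree (z :: w) = degree w + degree [z] := by
  rcases z with p | p <;> simp [degree, List.countP_cons] <;> ring

theorem degree_eq_zero_iff {w : LWord m n} : degree w = 0 ↔ Balanced w := by
  simp only [degree, Balanced]
  omega

end LWord

namespace Leavitt

open LWord
open Finsupp hiding degree

variable (K : Type) [Field K] {m n : ℕ}

/-- The word `z :: w` rewritten by at most one application of the defining relations at its
first two letters; this is the normal form of `z :: w` when `w` is irreducible. -/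
noncomputable def reduceCons : LGen m n → LWord m n → (LWord m n →₀ K)
  | Sum.inl (i, j), Sum.inr (j', i') :: v =>
    if (j : ℕ) = n - 1 ∧ j' = j then
      (if i = i' then single v 1 else 0) -
        ∑ k ∈ Finset.univ.erase j, single (Sum.inl (i, k) :: Sum.inr (k, i') :: v) 1
    else single (Sum.inl (i, j) :: Sum.inr (j', i') :: v) 1
  | Sum.inr (j, i), Sum.inl (i', j') :: v =>
    if (i : ℕ) = m - 1 ∧ i' = i then
      (if j = j' then single v 1 else 0) -
        ∑ k ∈ Finset.univ.erase i, single (Sum.inr (j, k) :: Sum.inl (k, j') :: v) 1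
    else single (Sum.inr (j, i) :: Sum.inl (i', j') :: v) 1
  | z, w => single (z :: w) 1

theorem reduceCons_of_irr {z : LGen m n} {w : LWord m n} (h : Irr (z :: w)) :
    reduceCons K z w = single (z :: w) 1 := by
  rcases z with ⟨i, j⟩ | ⟨j, i⟩ <;> rcases w with _ | ⟨⟨a, b⟩ | ⟨b, a⟩, v⟩ <;>
    simp only [reduceCons]
  · rw [irr_cons_cons, forbidden_inl_inr] at h
    rw [if_neg h.1]
  · rw [irr_cons_cons, forbidden_inr_inl] at h
    rw [if_neg h.1]

theorem reduceCons_mem (z : LGen m n) {w : LWord m n} (hw : Irr w) :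
    reduceCons K z w ∈ supported K K {u | Irr u ∧ degree u = degree w + degree [z]} := by
  by_cases h : Irr (z :: w)
  · rw [reduceCons_of_irr K h]
    exact single_mem_supported K _ ⟨h, degree_cons z w⟩
  rcases z with ⟨i, j⟩ | ⟨j, i⟩ <;> rcases w with _ | ⟨⟨a, b⟩ | ⟨b, a⟩, v⟩
  · exact absurd (irr_singleton _) h
  · exact absurd (irr_cons_cons.2 ⟨not_forbidden_inl_inl _ _, hw⟩) h
  · have hf : (j : ℕ) = n - 1 ∧ b = j := by
      by_contra hf
      exact h (irr_cons_cons.2 ⟨fun h' => hf (forbidden_inl_inr.1 h'), hw⟩)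
    simp only [reduceCons, if_pos hf]
    refine Submodule.sub_mem _ ?_ (Submodule.sum_mem _ fun k hk => ?_)
    · split_ifs
      · refine single_mem_supported K _ ⟨hw.tail, ?_⟩
        simp [degree_cons_inl, degree_cons_inr, degree_nil]
      · exact Submodule.zero_mem _
    · refine single_mem_supported K _ ⟨irr_cons_cons.2 ⟨?_, hw.replace_inr⟩, ?_⟩
      · rw [forbidden_inl_inr]
        rintro ⟨hk', -⟩
        exact (Finset.mem_erase.1 hk).1 (Fin.ext (hk'.trans hf.1.symm))
      · simp [degree_cons_inl, degree_cons_inr, degree_nil]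
  · exact absurd (irr_singleton _) h
  · have hf : (i : ℕ) = m - 1 ∧ a = i := by
      by_contra hf
      exact h (irr_cons_cons.2 ⟨fun h' => hf (forbidden_inr_inl.1 h'), hw⟩)
    simp only [reduceCons, if_pos hf]
    refine Submodule.sub_mem _ ?_ (Submodule.sum_mem _ fun k hk => ?_)
    · split_ifs
      · refine single_mem_supported K _ ⟨hw.tail, ?_⟩
        simp [degree_cons_inl, degree_cons_inr, degree_nil]
      · exact Submodule.zero_mem _
    · refine single_mem_supported K _ ⟨irr_cons_cons.2 ⟨?_, hw.replace_inl⟩, ?_⟩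
      · rw [forbidden_inr_inl]
        rintro ⟨hk', -⟩
        exact (Finset.mem_erase.1 hk).1 (Fin.ext (hk'.trans hf.1.symm))
      · simp [degree_cons_inl, degree_cons_inr, degree_nil]
  · exact absurd (irr_cons_cons.2 ⟨not_forbidden_inr_inr _ _, hw⟩) h

/-- The linear extension of `reduceCons` to formal combinations of words. -/
noncomputable def reduceConsLin (z : LGen m n) : (LWord m n →₀ K) →ₗ[K] (LWord m n →₀ K) :=
  linearCombination K (reduceCons K z)

theorem reduceConsLin_single (z : LGen m n) (w : LWord m n) :
    reduceConsLin K z (single w 1) = reduceCons K z w := by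
  simp [reduceConsLin]

theorem sum_reduceCons_inl_inr (hn : 0 < n) (i i' : Fin m) (w : LWord m n) :
    ∑ j : Fin n, reduceCons K (Sum.inl (i, j)) (Sum.inr (j, i') :: w) =
      if i = i' then single w 1 else 0 := by
  have hl : ((⟨n - 1, by omega⟩ : Fin n) : ℕ) = n - 1 := rfl
  generalize (⟨n - 1, by omega⟩ : Fin n) = l at hl
  rw [← Finset.add_sum_erase _ _ (Finset.mem_univ l)]
  have h : ∀ j ∈ Finset.univ.erase l, reduceCons K (Sum.inl (i, j)) (Sum.inr (j, i') :: w) =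
      single (Sum.inl (i, j) :: Sum.inr (j, i') :: w) 1 := by
    intro j hj
    simp only [reduceCons]
    exact if_neg fun h' => (Finset.mem_erase.1 hj).1 (Fin.ext (h'.1.trans hl.symm))
  rw [Finset.sum_congr rfl h]
  simp only [reduceCons, hl, and_self, if_true]
  exact sub_add_cancel _ _

theorem sum_reduceCons_inr_inl (hm : 0 < m) (j j' : Fin n) (w : LWord m n) :
    ∑ i : Fin m, reduceCons K (Sum.inr (j, i)) (Sum.inl (i, j') :: w) =
      if j = j' then single w 1 else 0 := by
  have hl : ((⟨m - 1, by omega⟩ : Fin m) : ℕ) = m - 1 := rfl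
  generalize (⟨m - 1, by omega⟩ : Fin m) = l at hl
  rw [← Finset.add_sum_erase _ _ (Finset.mem_univ l)]
  have h : ∀ i ∈ Finset.univ.erase l, reduceCons K (Sum.inr (j, i)) (Sum.inl (i, j') :: w) =
      single (Sum.inr (j, i) :: Sum.inl (i, j') :: w) 1 := by
    intro i hi
    simp only [reduceCons]
    exact if_neg fun h' => (Finset.mem_erase.1 hi).1 (Fin.ext (h'.1.trans hl.symm))
  rw [Finset.sum_congr rfl h]
  simp only [reduceCons, hl, and_self, if_true]
  exact sub_add_cancel _ _

theorem sum_reduceConsLin_inl_inr (hn : 0 < n) (i i' : Fin m) {w : LWord m n} (hw : Irr w) :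
    ∑ j : Fin n, reduceConsLin K (Sum.inl (i, j)) (reduceCons K (Sum.inr (j, i')) w) =
      if i = i' then single w 1 else 0 := by
  by_cases h : ∀ j : Fin n, Irr (Sum.inr (j, i') :: w)
  · simp only [reduceCons_of_irr K (h _), reduceConsLin_single]
    exact sum_reduceCons_inl_inr K hn i i' w
  obtain ⟨j₀, hj₀⟩ := not_forall.1 h
  rcases w with _ | ⟨⟨a, b⟩ | ⟨b, a⟩, v⟩
  · exact absurd (irr_singleton _) hj₀
  · have hf : (i' : ℕ) = m - 1 ∧ a = i' := by
      by_contra hf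
      exact hj₀ (irr_cons_cons.2 ⟨fun h' => hf (forbidden_inr_inl.1 h'), hw⟩)
    obtain rfl := hf.2
    have hb : reduceCons K (Sum.inl (i, b)) v = single (Sum.inl (i, b) :: v) 1 :=
      reduceCons_of_irr K hw.replace_inl
    have hr : ∀ j : Fin n, reduceCons K (Sum.inr (j, a)) (Sum.inl (a, b) :: v) =
        (if j = b then single v 1 else 0) -
          ∑ k ∈ Finset.univ.erase a, single (Sum.inr (j, k) :: Sum.inl (k, b) :: v) 1 :=
      fun j => if_pos hf
    simp only [hr, map_sub, map_sum, reduceConsLin_single, Finset.sum_sub_distrib,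
      apply_ite (reduceConsLin K _), map_zero]
    rw [Finset.sum_comm]
    simp only [sum_reduceCons_inl_inr K hn, Finset.sum_ite_eq', Finset.sum_ite_eq,
      Finset.mem_univ, if_true, hb, Finset.mem_erase, and_true]
    by_cases hi : i = a <;> simp [hi]
  · exact absurd (irr_cons_cons.2 ⟨not_forbidden_inr_inr _ _, hw⟩) hj₀

theorem sum_reduceConsLin_inr_inl (hm : 0 < m) (j j' : Fin n) {w : LWord m n} (hw : Irr w) :
    ∑ i : Fin m, reduceConsLin K (Sum.inr (j, i)) (reduceCons K (Sum.inl (i, j')) w) =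
      if j = j' then single w 1 else 0 := by
  by_cases h : ∀ i : Fin m, Irr (Sum.inl (i, j') :: w)
  · simp only [reduceCons_of_irr K (h _), reduceConsLin_single]
    exact sum_reduceCons_inr_inl K hm j j' w
  obtain ⟨i₀, hi₀⟩ := not_forall.1 h
  rcases w with _ | ⟨⟨a, b⟩ | ⟨b, a⟩, v⟩
  · exact absurd (irr_singleton _) hi₀
  · exact absurd (irr_cons_cons.2 ⟨not_forbidden_inl_inl _ _, hw⟩) hi₀
  · have hf : (j' : ℕ) = n - 1 ∧ b = j' := by
      by_contra hf
      exact hi₀ (irr_cons_cons.2 ⟨fun h' => hf (forbidden_inl_inr.1 h'), hw⟩)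
    obtain rfl := hf.2
    have hb : reduceCons K (Sum.inr (j, a)) v = single (Sum.inr (j, a) :: v) 1 :=
      reduceCons_of_irr K hw.replace_inr
    have hr : ∀ i : Fin m, reduceCons K (Sum.inl (i, b)) (Sum.inr (b, a) :: v) =
        (if i = a then single v 1 else 0) -
          ∑ k ∈ Finset.univ.erase b, single (Sum.inl (i, k) :: Sum.inr (k, a) :: v) 1 :=
      fun i => if_pos hf
    simp only [hr, map_sub, map_sum, reduceConsLin_single, Finset.sum_sub_distrib,
      apply_ite (reduceConsLin K _), map_zero]
    rw [Finset.sum_comm]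
    simp only [sum_reduceCons_inr_inl K hm, Finset.sum_ite_eq', Finset.sum_ite_eq,
      Finset.mem_univ, if_true, hb, Finset.mem_erase, and_true]
    by_cases hj : j = b <;> simp [hj]

/-- The formal combinations of irreducible words. -/
abbrev IrrSpan (m n : ℕ) : Submodule K (LWord m n →₀ K) :=
  supported K K {w | Irr w}

theorem reduceConsLin_mem (z : LGen m n) {s t : Set (LWord m n)}
    (h : ∀ w ∈ s, reduceCons K z w ∈ supported K K t) {f : LWord m n →₀ K}
    (hf : f ∈ supported K K s) : reduceConsLin K z f ∈ supported K K t := by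
  rw [reduceConsLin, linearCombination_apply]
  exact Submodule.sum_mem _ fun w hw => Submodule.smul_mem _ _ (h w (hf hw))

/-- The action of a generator on the formal combinations of irreducible words. -/
noncomputable def genAct (z : LGen m n) : Module.End K (IrrSpan K m n) :=
  (reduceConsLin K z).restrict fun _ hf =>
    reduceConsLin_mem K z (fun _ hw => supported_mono (fun _ hu => hu.1) (reduceCons_mem K z hw)) hf

theorem coe_genAct (z : LGen m n) (f : IrrSpan K m n) :
    (genAct K z f : LWord m n →₀ K) = reduceConsLin K z f := rfl

theorem end_irrSpan_ext {f g : Module.End K (IrrSpan K m n)}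
    (h : ∀ (w : LWord m n) (hw : Irr w),
      (f ⟨single w 1, single_mem_supported K _ hw⟩ : LWord m n →₀ K) =
        g ⟨single w 1, single_mem_supported K _ hw⟩) : f = g := by
  ext1 ⟨x, hx⟩
  have hx' := hx
  rw [IrrSpan, supported_eq_span_single] at hx'
  induction hx' using Submodule.span_induction with
  | mem x hx' =>
    obtain ⟨w, hw, rfl⟩ := hx'
    exact Subtype.ext (h w hw)
  | zero => exact (map_zero f).trans (map_zero g).symm
  | add x y hx₁ hy₁ ihx ihy =>
    rw [← supported_eq_span_single] at hx₁ hy₁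
    have := congrArg₂ (· + ·) (ihx hx₁) (ihy hy₁)
    simp only [← map_add] at this
    exact this
  | smul c x hx₁ ihx =>
    rw [← supported_eq_span_single] at hx₁
    have := congrArg (c • ·) (ihx hx₁)
    simp only [← map_smul] at this
    exact this

/-- The representation of `L(m,n)` on the formal combinations of irreducible words. -/
noncomputable def irrRep (hm : 0 < m) (hn : 0 < n) :
    Leavitt K m n →ₐ[K] Module.End K (IrrSpan K m n) :=
  RingQuot.liftAlgHom K ⟨FreeAlgebra.lift K (genAct K), by
    intro a b hab
    cases hab with
    | xy i i' =>
      refine end_irrSpan_ext K fun w hw => ?_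
      have := sum_reduceConsLin_inl_inr K hn i i' hw
      simp only [map_sum, map_mul, FreeAlgebra.lift_ι_apply, LinearMap.sum_apply,
        Submodule.coe_sum, Module.End.mul_apply, coe_genAct, reduceConsLin_single, this]
      split_ifs <;> simp
    | yx j j' =>
      refine end_irrSpan_ext K fun w hw => ?_
      have := sum_reduceConsLin_inr_inl K hm j j' hw
      simp only [map_sum, map_mul, FreeAlgebra.lift_ι_apply, LinearMap.sum_apply,
        Submodule.coe_sum, Module.End.mul_apply, coe_genAct, reduceConsLin_single, this]
      split_ifs <;> simp⟩

theorem irrRep_lgen (hm : 0 < m) (hn : 0 < n) (z : LGen m n) :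
    irrRep K hm hn (lgen K z) = genAct K z := by
  simp [irrRep, lgen]

theorem wordToL_cons (z : LGen m n) (w : LWord m n) :
    wordToL K (z :: w) = lgen K z * wordToL K w := by
  simp [wordToL]

theorem irrRep_wordToL (hm : 0 < m) (hn : 0 < n) {w : LWord m n} (hw : Irr w) :
    (irrRep K hm hn (wordToL K w) ⟨single [] 1, single_mem_supported K _ irr_nil⟩ :
      LWord m n →₀ K) = single w 1 := by
  induction w with
  | nil => simp [wordToL]
  | cons z w ih =>
    rw [wordToL_cons, map_mul, Module.End.mul_apply, irrRep_lgen, coe_genAct, ih hw.tail,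
      reduceConsLin_single, reduceCons_of_irr K hw]

theorem linearIndependent_wordToL (hm : 0 < m) (hn : 0 < n) :
    LinearIndependent K (fun w : {w : LWord m n // w.Irr} => wordToL K w.1) := by
  let φ : Leavitt K m n →ₗ[K] (LWord m n →₀ K) :=
    (IrrSpan K m n).subtype ∘ₗ
      LinearMap.applyₗ ⟨single [] 1, single_mem_supported K _ irr_nil⟩ ∘ₗ
        (irrRep K hm hn).toLinearMap
  have hφ : φ ∘ (fun w : {w : LWord m n // w.Irr} => wordToL K w.1) =
      (fun w : LWord m n => single w (1 : K)) ∘ Subtype.val :=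
    funext fun w => irrRep_wordToL K hm hn w.2
  refine LinearIndependent.of_comp φ ?_
  rw [hφ]
  exact (Finsupp.linearIndependent_single_one K (LWord m n)).comp _ Subtype.val_injective

theorem sum_lgen_inl_inr (i i' : Fin m) :
    ∑ j : Fin n, lgen K (Sum.inl (i, j)) * lgen K (Sum.inr (j, i')) =
      (if i = i' then 1 else 0 : Leavitt K m n) := by
  have := RingQuot.mkAlgHom_rel K (LRel.xy (K := K) (n := n) i i')
  simp only [map_sum, map_mul, apply_ite (RingQuot.mkAlgHom K (LRel K m n)), map_one,
    map_zero] at this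
  exact this

theorem sum_lgen_inr_inl (j j' : Fin n) :
    ∑ i : Fin m, lgen K (Sum.inr (j, i)) * lgen K (Sum.inl (i, j')) =
      (if j = j' then 1 else 0 : Leavitt K m n) := by
  have := RingQuot.mkAlgHom_rel K (LRel.yx (K := K) (m := m) j j')
  simp only [map_sum, map_mul, apply_ite (RingQuot.mkAlgHom K (LRel K m n)), map_one,
    map_zero] at this
  exact this

theorem linearCombination_reduceCons (z : LGen m n) (w : LWord m n) :
    linearCombination K (wordToL K) (reduceCons K z w) = lgen K z * wordToL K w := by
  rcases z with ⟨i, j⟩ | ⟨j, i⟩ <;> rcases w with _ | ⟨⟨a, b⟩ | ⟨b, a⟩, v⟩ <;>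
    simp only [reduceCons, linearCombination_single, one_smul, wordToL_cons]
  · split_ifs with hf hi
    all_goals
      simp only [map_sub, map_sum, linearCombination_single, one_smul, wordToL_cons, map_zero]
    all_goals
      obtain ⟨-, rfl⟩ := hf
      have h := congrArg (· * wordToL K v) (sum_lgen_inl_inr K (n := n) i a)
      simp only [← Finset.add_sum_erase _ _ (Finset.mem_univ b), add_mul, Finset.sum_mul,
        mul_assoc] at h
      rw [sub_eq_iff_eq_add, h]
      simp [hi]
  · split_ifs with hf hj
    all_goals
      simp only [map_sub, map_sum, linearCombination_single, one_smul, wordToL_cons, map_zero]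
    all_goals
      obtain ⟨-, rfl⟩ := hf
      have h := congrArg (· * wordToL K v) (sum_lgen_inr_inl K (m := m) j b)
      simp only [← Finset.add_sum_erase _ _ (Finset.mem_univ a), add_mul, Finset.sum_mul,
        mul_assoc] at h
      rw [sub_eq_iff_eq_add, h]
      simp [hj]

theorem linearCombination_reduceConsLin (z : LGen m n) (f : LWord m n →₀ K) :
    linearCombination K (wordToL K) (reduceConsLin K z f) =
      lgen K z * linearCombination K (wordToL K) f := by
  have : linearCombination K (wordToL K) ∘ₗ reduceConsLin K z =
      LinearMap.mulLeft K (lgen K z) ∘ₗ linearCombination K (wordToL K) := by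
    ext w
    simp [reduceConsLin_single, linearCombination_reduceCons]
  exact LinearMap.congr_fun this f

theorem exists_normalForm (w : LWord m n) :
    ∃ f ∈ supported K K {u : LWord m n | Irr u ∧ degree u = degree w},
      linearCombination K (wordToL K) f = wordToL K w := by
  induction w with
  | nil => exact ⟨single [] 1, single_mem_supported K _ ⟨irr_nil, rfl⟩, by simp⟩
  | cons z w ih =>
    obtain ⟨f, hf, hfw⟩ := ih
    refine ⟨reduceConsLin K z f, ?_, ?_⟩
    · rw [degree_cons]
      exact reduceConsLin_mem K z (fun u hu => hu.2 ▸ reduceCons_mem K z hu.1) hf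
    · rw [linearCombination_reduceConsLin, hfw, wordToL_cons]

/-- Every homogeneous component is spanned by its irreducible words. -/
theorem span_irr_eq_Lcomponent (d : ℤ) :
    Submodule.span K (wordToL K '' {w : LWord m n | Irr w ∧ degree w = d}) =
      Lcomponent K m n d := by
  refine le_antisymm (Submodule.span_mono ?_) (Submodule.span_le.2 ?_)
  · rintro _ ⟨w, ⟨-, hw⟩, rfl⟩
    exact ⟨w, hw, rfl⟩
  · rintro _ ⟨w, rfl, rfl⟩
    exact (mem_span_image_iff_linearCombination K).2 (exists_normalForm K w)

end Leavitt

/-- The images in `L(m,n)` of the irreducible balanced words form a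
`K`-linear basis of the zero component `L(m,n)₀` of the canonical grading. -/
theorem stmt3 (K : Type) [Field K] (m n : ℕ) (hm : 0 < m) (hn : 0 < n) :
    LinearIndependent K
      (fun w : {w : LWord m n // w.Irr ∧ w.Balanced} => wordToL K w.1) ∧
    Submodule.span K
        (Set.range fun w : {w : LWord m n // w.Irr ∧ w.Balanced} => wordToL K w.1) =
      Lcomponent K m n 0 := by
  constructor
  · exact (Leavitt.linearIndependent_wordToL K hm hn).comp
      (fun w : {w : LWord m n // w.Irr ∧ w.Balanced} =>
        (⟨w.1, w.2.1⟩ : {w : LWord m n // w.Irr}))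
      fun u v h => Subtype.ext (Subtype.mk.inj h)
  · rw [← Leavitt.span_irr_eq_Lcomponent]
    congr 1
    ext a
    simp [LWord.degree_eq_zero_iff]
end

section
/- Every prime word in ⟨X⟩_0 is either an xy word or a yx word. -/
open scoped BigOperators

/-- Discrete intermediate value property: appending one letter changes the difference of two
letter counts by at most one, so the difference vanishes at some prefix between a positive and a
negative value. -/
theorem List.exists_append_countP_eq {α : Type*} (p q : α → Bool) (s t : List α)
    (hs : s.countP q < s.countP p) (hst : (s ++ t).countP p < (s ++ t).countP q) :
    ∃ u v, t = u ++ v ∧ (s ++ u).countP p = (s ++ u).countP q := by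
  induction t generalizing s with
  | nil =>
    rw [List.append_nil] at hst
    omega
  | cons a t ih =>
    rcases Nat.lt_or_ge ((s ++ [a]).countP q) ((s ++ [a]).countP p) with h | h
    · obtain ⟨u, v, rfl, huv⟩ := ih (s ++ [a]) h (by simpa using hst)
      exact ⟨a :: u, v, rfl, by simpa using huv⟩
    · refine ⟨[a], t, rfl, ?_⟩
      simp only [List.countP_append, List.countP_singleton] at h ⊢
      split_ifs at h ⊢ <;> omega

/-- If a letter counted by `p` but not by `q` starts a word and another such letter ends it, and
`p` and `q` count equally many letters, then some proper nonempty prefix has the same property. -/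
theorem List.exists_prefix_countP_eq {α : Type*} {p q : α → Bool} {a b : α} {l : List α}
    (hpa : p a = true) (hqa : q a = false) (hpb : p b = true) (hqb : q b = false)
    (h : (a :: (l ++ [b])).countP p = (a :: (l ++ [b])).countP q) :
    ∃ u v, l = u ++ v ∧ (a :: u).countP p = (a :: u).countP q := by
  refine List.exists_append_countP_eq p q [a] l (by simp [hpa, hqa]) ?_
  simp only [List.countP_cons, List.countP_append, List.countP_nil, hpa, hqa, hpb, hqb] at h ⊢
  simp at h ⊢
  omega

/-- Every prime word in `⟨X⟩₀` is either an xy word or a yx word. -/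
theorem stmt5 (m n : ℕ) (hm : 0 < m) (hn : 0 < n) :
    ∀ w : LWord m n, w.IsPrime → w.XY ∨ w.YX := by
  rintro w ⟨hne, hbal, hprime⟩
  obtain ⟨a, w, rfl⟩ := List.exists_cons_of_ne_nil hne
  rcases List.eq_nil_or_concat' w with rfl | ⟨l, b, rfl⟩
  · cases a <;> simp [LWord.Balanced] at hbal
  have no_split : ∀ u v, l = u ++ v → ¬ LWord.Balanced (a :: u) := fun u v huv =>
    hprime (a :: u) (v ++ [b]) (by simp [huv]) (by simp) (by simp)
  have last : (a :: (l ++ [b])).getLast? = some b := by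
    rw [← List.cons_append, List.getLast?_concat]
  rcases a with x | y <;> rcases b with x' | y'
  · obtain ⟨u, v, huv, hu⟩ := List.exists_prefix_countP_eq rfl rfl rfl rfl hbal
    exact (no_split u v huv hu).elim
  · exact Or.inl ⟨hbal, ⟨x, rfl⟩, ⟨y', last⟩⟩
  · exact Or.inr ⟨hbal, ⟨y, rfl⟩, ⟨x', last⟩⟩
  · obtain ⟨u, v, huv, hu⟩ := List.exists_prefix_countP_eq rfl rfl rfl rfl hbal.symm
    exact (no_split u v huv hu.symm).elim
end

section
/- An xy word (respectively yx word) w is prime if and only if the type of w has the form (k_1−r_0, k_1−r_1, k_2−r_1, k_2−r_2, …, k_p−r_{p−1}, k_p−r_p) for some integers p, k_1, …, k_p ≥ 1 and r_0, …, r_p with r_0 = r_p = 0 and 0 < r_i < min(k_i, k_{i+1}) for all 1 ≤ i ≤ p−1. -/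
open scoped BigOperators

/-- `HasTypeXY w t` : the word `w` decomposes into alternating nonempty blocks
(x-block, y-block, x-block, …) whose lengths are recorded in `t`; this is the
"type" of an xy word. -/
inductive HasTypeXY {m n : ℕ} : LWord m n → List (ℕ × ℕ) → Prop
  | nil : HasTypeXY [] []
  | cons (a b : ℕ) (u v w : LWord m n) (t : List (ℕ × ℕ)) :
      0 < a → 0 < b → u.length = a → v.length = b →
      (∀ z ∈ u, z.isLeft = true) → (∀ z ∈ v, z.isRight = true) →
      HasTypeXY w t → HasTypeXY (u ++ v ++ w) ((a, b) :: t)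

/-- `HasTypeYX w t` : the analogous block decomposition starting with a y-block. -/
inductive HasTypeYX {m n : ℕ} : LWord m n → List (ℕ × ℕ) → Prop
  | nil : HasTypeYX [] []
  | cons (a b : ℕ) (u v w : LWord m n) (t : List (ℕ × ℕ)) :
      0 < a → 0 < b → u.length = a → v.length = b →
      (∀ z ∈ u, z.isRight = true) → (∀ z ∈ v, z.isLeft = true) →
      HasTypeYX w t → HasTypeYX (u ++ v ++ w) ((a, b) :: t)

/-- The condition on a type `t` from Lemma `lemprime3`: `t` has the form
`(k₁−r₀, k₁−r₁, k₂−r₁, k₂−r₂, …, k_p−r_{p−1}, k_p−r_p)` with `p, k₁, …, k_p ≥ 1`,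
`r₀ = r_p = 0` and `0 < r_i < min (k_i) (k_{i+1})` for `1 ≤ i ≤ p−1`. -/
def TypeCond (t : List (ℕ × ℕ)) : Prop :=
  ∃ (p : ℕ) (k r : ℕ → ℕ), 1 ≤ p ∧ (∀ i, 1 ≤ i → i ≤ p → 1 ≤ k i) ∧
    r 0 = 0 ∧ r p = 0 ∧
    (∀ i, 1 ≤ i → i ≤ p - 1 → 0 < r i ∧ r i < min (k i) (k (i + 1))) ∧
    t = (List.range p).map (fun i => (k (i + 1) - r i, k (i + 1) - r (i + 1)))

/-- `BlockType p w t`: the list `w` decomposes into alternating nonempty blocks on which the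
predicate `p` is true, false, true, …, with consecutive block lengths recorded in `t`. -/
inductive BlockType {α : Type*} (p : α → Bool) : List α → List (ℕ × ℕ) → Prop
  | nil : BlockType p [] []
  | cons (u v w : List α) (t : List (ℕ × ℕ)) :
      0 < u.length → 0 < v.length → (∀ z ∈ u, p z = true) → (∀ z ∈ v, p z = false) →
      BlockType p w t → BlockType p (u ++ v ++ w) ((u.length, v.length) :: t)

/-- The number of entries satisfying `p` minus the number of entries not satisfying `p`. -/
def signedCount {α : Type*} (p : α → Bool) (w : List α) : ℤ :=
  w.countP p - w.countP (fun z => !p z)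

/-- The lattice path with ascents and descents recorded in `t`, started at height `h`, stays
positive after its first ascent and reaches height `0` exactly at its end. -/
def PositivePath : ℕ → List (ℕ × ℕ) → Prop
  | h, [] => h = 0
  | h, (a, b) :: t => b ≤ h + a ∧ (t = [] ∨ b < h + a) ∧ PositivePath (h + a - b) t

/-- The type condition with an arbitrary initial value `r 0 = h`. -/
def TypeCondFrom (h : ℕ) (t : List (ℕ × ℕ)) : Prop :=
  ∃ (p : ℕ) (k r : ℕ → ℕ), 1 ≤ p ∧ (∀ i, 1 ≤ i → i ≤ p → 1 ≤ k i) ∧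
    r 0 = h ∧ r p = 0 ∧
    (∀ i, 1 ≤ i → i ≤ p - 1 → 0 < r i ∧ r i < min (k i) (k (i + 1))) ∧
    t = (List.range p).map (fun i => (k (i + 1) - r i, k (i + 1) - r (i + 1)))

section signedCount

variable {α : Type*} {p : α → Bool}

theorem signedCount_nil : signedCount p [] = 0 := by simp [signedCount]

theorem signedCount_append (u v : List α) :
    signedCount p (u ++ v) = signedCount p u + signedCount p v := by
  simp only [signedCount, List.countP_append]
  push_cast
  ring

theorem signedCount_of_forall_true {u : List α} (hu : ∀ z ∈ u, p z = true) :
    signedCount p u = u.length := by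
  have h₁ : u.countP p = u.length := List.countP_eq_length.2 hu
  have h₂ : u.countP (fun z => !p z) = 0 := List.countP_eq_zero.2 (by simpa using hu)
  simp [signedCount, h₁, h₂]

theorem signedCount_of_forall_false {u : List α} (hu : ∀ z ∈ u, p z = false) :
    signedCount p u = -u.length := by
  have h₁ : u.countP p = 0 := List.countP_eq_zero.2 (by simpa using hu)
  have h₂ : u.countP (fun z => !p z) = u.length := List.countP_eq_length.2 (by simpa using hu)
  simp [signedCount, h₁, h₂]

theorem signedCount_blocks {u v : List α} (hu : ∀ z ∈ u, p z = true)
    (hv : ∀ z ∈ v, p z = false) (w : List α) :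
    signedCount p (u ++ v ++ w) = u.length - v.length + signedCount p w := by
  rw [signedCount_append, signedCount_append, signedCount_of_forall_true hu,
    signedCount_of_forall_false hv]
  ring

theorem signedCount_take_blocks {u v : List α} (hu : ∀ z ∈ u, p z = true)
    (hv : ∀ z ∈ v, p z = false) (w : List α) (i : ℕ) :
    signedCount p ((u ++ v ++ w).take i) =
      (min i u.length : ℕ) - (min (i - u.length) v.length : ℕ) +
        signedCount p (w.take (i - (u.length + v.length))) := by
  rw [List.take_append, List.take_append,
    signedCount_blocks (fun z hz => hu z (List.mem_of_mem_take hz))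
      (fun z hz => hv z (List.mem_of_mem_take hz))]
  simp [List.length_take]

end signedCount

theorem BlockType.pos {α : Type*} {p : α → Bool} {w : List α} {t : List (ℕ × ℕ)}
    (H : BlockType p w t) : ∀ c ∈ t, 0 < c.1 ∧ 0 < c.2 := by
  induction H with
  | nil => simp
  | cons u v w t ha hb _ _ _ ih =>
    rintro c hc
    rcases List.mem_cons.1 hc with rfl | hc
    · exact ⟨ha, hb⟩
    · exact ih c hc

theorem BlockType.eq_nil_iff {α : Type*} {p : α → Bool} {w : List α} {t : List (ℕ × ℕ)}
    (H : BlockType p w t) : w = [] ↔ t = [] := by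
  cases H with
  | nil => simp
  | cons u v w t ha hb _ _ _ => simp [List.length_pos_iff.1 ha]

theorem BlockType.positivePath_iff {α : Type*} {p : α → Bool} {w : List α} {t : List (ℕ × ℕ)}
    (H : BlockType p w t) (h : ℕ) :
    PositivePath h t ↔ h + signedCount p w = 0 ∧
      ∀ i, 0 < i → i < w.length → h + signedCount p (w.take i) ≠ 0 := by
  induction H generalizing h with
  | nil => simp [PositivePath, signedCount_nil]
  | cons u v w t ha hb hu hv H ih =>
    rw [PositivePath, ih, signedCount_blocks hu hv]
    simp only [signedCount_take_blocks hu hv, List.length_append]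
    constructor
    · rintro ⟨hle, hlt, hsum, hne⟩
      refine ⟨by omega, fun i hi hil => ?_⟩
      rcases le_or_gt i (u.length + v.length) with hi' | hi'
      · have hlt' : t = [] → i < u.length + v.length := by
          intro ht
          have := H.eq_nil_iff.2 ht
          simpa [this] using hil
        rw [Nat.sub_eq_zero_of_le hi', List.take_zero, signedCount_nil]
        by_cases ht : t = []
        · have := hlt' ht
          omega
        · have := hlt.resolve_left ht
          omega
      · have := hne (i - (u.length + v.length)) (by omega) (by omega)
        omega
    · rintro ⟨hsum, hne⟩
      by_cases ht : t = []
      · obtain rfl := H.eq_nil_iff.2 ht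
        rw [signedCount_nil] at hsum
        refine ⟨by omega, Or.inl ht, ?_, by simp⟩
        rw [signedCount_nil]
        omega
      · have hw : 0 < w.length := List.length_pos_iff.2 (fun hw => ht (H.eq_nil_iff.1 hw))
        have hlt : v.length < h + u.length := by
          by_contra! hle
          apply hne (u.length + (h + u.length)) (by omega) (by omega)
          rw [show u.length + (h + u.length) - (u.length + v.length) = 0 by omega,
            List.take_zero, signedCount_nil]
          omega
        refine ⟨hlt.le, Or.inr hlt, by omega, fun i hi hil => ?_⟩
        have := hne (i + (u.length + v.length)) (by omega) (by omega)
        rw [Nat.add_sub_cancel] at this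
        omega

theorem positivePath_iff_typeCondFrom {t : List (ℕ × ℕ)} (ht : t ≠ [])
    (hpos : ∀ c ∈ t, 0 < c.1 ∧ 0 < c.2) (h : ℕ) :
    PositivePath h t ↔ TypeCondFrom h t := by
  induction t generalizing h with
  | nil => exact absurd rfl ht
  | cons c t ih =>
    obtain ⟨a, b⟩ := c
    obtain ⟨ha, hb⟩ : 0 < a ∧ 0 < b := hpos (a, b) (by simp)
    have hpos' : ∀ c ∈ t, 0 < c.1 ∧ 0 < c.2 := fun c hc => hpos c (List.mem_cons_of_mem _ hc)
    rw [PositivePath]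
    constructor
    · rintro ⟨hle, hlt, hP⟩
      by_cases ht' : t = []
      · subst ht'
        rw [PositivePath] at hP
        refine ⟨1, fun _ => h + a, fun i => if i = 0 then h else 0, le_rfl,
          fun _ _ _ => by dsimp only; omega, rfl, rfl, fun i _ _ => by omega, ?_⟩
        simp
        omega
      · have hlt := hlt.resolve_left ht'
        obtain ⟨p, k, r, hp, hk, hr0, hrp, hr, rfl⟩ := (ih ht' hpos' _).1 hP
        have hk1 : r 0 < k 1 := by
          have := (hpos' (k (0 + 1) - r 0, k (0 + 1) - r (0 + 1))
            (List.mem_map.2 ⟨0, List.mem_range.2 hp, rfl⟩)).1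
          simpa using this
        refine ⟨p + 1, fun i => if i ≤ 1 then h + a else k (i - 1),
          fun i => if i = 0 then h else r (i - 1), by omega, ?_, rfl, ?_, ?_, ?_⟩
        · intro i hi hip
          dsimp only
          split_ifs with hi1
          · omega
          · exact hk _ (by omega) (by omega)
        · simpa using hrp
        · intro i hi hip
          rcases Nat.lt_or_ge 1 i with hi1 | hi1
          · obtain ⟨j, rfl⟩ : ∃ j, i = j + 2 := ⟨i - 2, by omega⟩
            simpa using hr (j + 1) (by omega) (by omega)
          · obtain rfl : i = 1 := by omega
            simp
            omega
        · rw [List.range_succ_eq_map, List.map_cons, List.map_map]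
          congr 1
          simp
          omega
    · rintro ⟨p, k, r, hp, hk, rfl, hrp, hr, hT⟩
      obtain ⟨p, rfl⟩ : ∃ q, p = q + 1 := ⟨p - 1, by omega⟩
      rw [List.range_succ_eq_map, List.map_cons, List.map_map] at hT
      obtain ⟨hab, rfl⟩ := List.cons.inj hT
      obtain ⟨rfl, rfl⟩ := Prod.mk.inj hab
      simp only [zero_add] at ha hb ⊢
      have hheight : r 0 + (k 1 - r 0) - (k 1 - r 1) = r 1 := by omega
      rw [hheight]
      rcases Nat.eq_zero_or_pos p with rfl | hp'
      · refine ⟨by omega, Or.inl rfl, ?_⟩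
        simpa [PositivePath] using hrp
      · have hr1 := hr 1 le_rfl (by omega)
        refine ⟨by omega, Or.inr (by omega), (ih (by simp; omega) hpos' _).2 ?_⟩
        exact ⟨p, fun i => k (i + 1), fun i => r (i + 1), hp', fun i _ _ => hk _ (by omega) (by omega),
          rfl, hrp, fun i _ _ => hr _ (by omega) (by omega), rfl⟩

theorem LWord.isPrime_iff_take {m n : ℕ} {p : LGen m n → Bool} {w : LWord m n}
    (hbal : ∀ u : LWord m n, u.Balanced ↔ signedCount p u = 0) :
    w.IsPrime ↔ w ≠ [] ∧ signedCount p w = 0 ∧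
      ∀ i, 0 < i → i < w.length → signedCount p (w.take i) ≠ 0 := by
  unfold LWord.IsPrime
  rw [hbal]
  refine and_congr_right fun hw => and_congr_right fun _ => ⟨fun H i hi hil => ?_, ?_⟩
  · rw [Ne, ← hbal]
    refine H _ (w.drop i) (List.take_append_drop i w).symm ?_ ?_
    · simp [hw]
      omega
    · simpa using hil
  · rintro H u v rfl hu hv
    have := H u.length (List.length_pos_iff.2 hu) (by simpa [List.length_pos_iff] using hv)
    rwa [List.take_left, Ne, ← hbal] at this

theorem BlockType.isPrime_iff {m n : ℕ} {p : LGen m n → Bool} {w : LWord m n}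
    {t : List (ℕ × ℕ)} (hbal : ∀ u : LWord m n, u.Balanced ↔ signedCount p u = 0)
    (H : BlockType p w t) : w.IsPrime ↔ TypeCond t := by
  rw [LWord.isPrime_iff_take hbal, Ne, H.eq_nil_iff]
  by_cases ht : t = []
  · subst ht
    refine iff_of_false (fun h => h.1 rfl) ?_
    rintro ⟨p, k, r, hp, -, -, -, -, hT⟩
    have := congrArg List.length hT
    simp at this
    omega
  · have := (H.positivePath_iff 0).symm.trans (positivePath_iff_typeCondFrom ht H.pos 0)
    simpa [ht, TypeCond, TypeCondFrom] using this

theorem LWord.balanced_iff_signedCount_isLeft {m n : ℕ} (u : LWord m n) :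
    u.Balanced ↔ signedCount Sum.isLeft u = 0 := by
  have h : u.countP (fun z => !z.isLeft) = u.countP Sum.isRight :=
    List.countP_congr fun z _ => by simp
  rw [LWord.Balanced, signedCount, h]
  omega

theorem LWord.balanced_iff_signedCount_isRight {m n : ℕ} (u : LWord m n) :
    u.Balanced ↔ signedCount Sum.isRight u = 0 := by
  have h : u.countP (fun z => !z.isRight) = u.countP Sum.isLeft :=
    List.countP_congr fun z _ => by simp
  rw [LWord.Balanced, signedCount, h]
  omega

theorem HasTypeXY.blockType {m n : ℕ} {w : LWord m n} {t : List (ℕ × ℕ)}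
    (H : HasTypeXY w t) : BlockType Sum.isLeft w t := by
  induction H with
  | nil => exact .nil
  | cons a b u v w t ha hb hua hvb hu hv _ ih =>
    subst hua hvb
    exact .cons u v w t ha hb hu (fun z hz => by simpa using hv z hz) ih

theorem HasTypeYX.blockType {m n : ℕ} {w : LWord m n} {t : List (ℕ × ℕ)}
    (H : HasTypeYX w t) : BlockType Sum.isRight w t := by
  induction H with
  | nil => exact .nil
  | cons a b u v w t ha hb hua hvb hu hv _ ih =>
    subst hua hvb
    exact .cons u v w t ha hb hu (fun z hz => by simpa using hv z hz) ih

/-- An xy word (respectively yx word) is prime if and only if its type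
has the form `(k₁−r₀, k₁−r₁, k₂−r₁, …, k_p−r_{p−1}, k_p−r_p)` with `r₀ = r_p = 0` and
`0 < r_i < min(k_i, k_{i+1})` for `1 ≤ i ≤ p−1`. -/
theorem stmt6 (m n : ℕ) (hm : 0 < m) (hn : 0 < n) :
    ∀ (w : LWord m n) (t : List (ℕ × ℕ)),
      (HasTypeXY w t → w.Balanced → (w.IsPrime ↔ TypeCond t)) ∧
      (HasTypeYX w t → w.Balanced → (w.IsPrime ↔ TypeCond t)) := by
  intro w t
  exact ⟨fun H _ => H.blockType.isPrime_iff LWord.balanced_iff_signedCount_isLeft,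
    fun H _ => H.blockType.isPrime_iff LWord.balanced_iff_signedCount_isRight⟩
end
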